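/- Let L be a two-dimensional complex Finsler metric on D. Then: (i) L is purely Hermitian if and only if A = 0 at every point of D; (ii) if A is nowhere zero on D and B = 0 on D, then I = 0 on D and ∂A/∂η̄^h = (3A/(2F))·l̄_h for all h, where l̄_h denotes the complex conjugate of l_h. -/

import Mathlib

open Complex

noncomputable section

namespace CFinsler

/-- A point of `T'M` in local coordinates: `(z, η) ∈ ℂⁿ × ℂⁿ`. -/
abbrev Pt (n : ℕ) := (Fin n → ℂ) × (Fin n → ℂ)

variable {n : ℕ}

/-- Wirtinger derivative `∂f/∂z^k`. -/
def dz (f : Pt n → ℂ) (k : Fin n) (p : Pt n) : ℂ :=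
  (1 / 2) * (fderiv ℝ f p ((Pi.single k 1 : Fin n → ℂ), 0) -
    Complex.I * fderiv ℝ f p ((Pi.single k Complex.I : Fin n → ℂ), 0))

/-- Wirtinger derivative `∂f/∂z̄^k`. -/
def dzbar (f : Pt n → ℂ) (k : Fin n) (p : Pt n) : ℂ :=
  (1 / 2) * (fderiv ℝ f p ((Pi.single k 1 : Fin n → ℂ), 0) +
    Complex.I * fderiv ℝ f p ((Pi.single k Complex.I : Fin n → ℂ), 0))

/-- Wirtinger derivative `∂f/∂η^k`. -/
def de (f : Pt n → ℂ) (k : Fin n) (p : Pt n) : ℂ :=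
  (1 / 2) * (fderiv ℝ f p (0, (Pi.single k 1 : Fin n → ℂ)) -
    Complex.I * fderiv ℝ f p (0, (Pi.single k Complex.I : Fin n → ℂ)))

/-- Wirtinger derivative `∂f/∂η̄^k`. -/
def debar (f : Pt n → ℂ) (k : Fin n) (p : Pt n) : ℂ :=
  (1 / 2) * (fderiv ℝ f p (0, (Pi.single k 1 : Fin n → ℂ)) +
    Complex.I * fderiv ℝ f p (0, (Pi.single k Complex.I : Fin n → ℂ)))

/-- The fundamental metric tensor `g_{i j̄} := ∂²L/∂η^i ∂η̄^j`. -/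
def gm (L : Pt n → ℂ) (i j : Fin n) : Pt n → ℂ := de (debar L j) i

/-- `L` is an `n`-dimensional complex Finsler metric on `D`. -/
structure IsCFM (n : ℕ) (D : Set (Pt n)) (L : Pt n → ℂ) : Prop where
  openD : IsOpen D
  fiber_ne : ∀ p ∈ D, p.2 ≠ 0
  conic : ∀ p ∈ D, ∀ lam : ℂ, lam ≠ 0 → (p.1, lam • p.2) ∈ D
  smooth : ContDiffOn ℝ (⊤ : ℕ∞) L D
  real_im : ∀ p ∈ D, (L p).im = 0
  pos : ∀ p ∈ D, 0 < (L p).re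
  homog : ∀ p ∈ D, ∀ lam : ℂ, lam ≠ 0 →
    L (p.1, lam • p.2) = ((Complex.normSq lam : ℝ) : ℂ) * L p
  hermitian : ∀ p ∈ D, ∀ i j, (starRingEnd ℂ) (gm L i j p) = gm L j i p
  posdef : ∀ p ∈ D, ∀ v : Fin n → ℂ, v ≠ 0 →
    0 < (∑ i, ∑ j, gm L i j p * v i * (starRingEnd ℂ) (v j)).re

variable (L : Pt n → ℂ)

/-- The metric tensor as a matrix at a point. -/
def gmat (p : Pt n) : Matrix (Fin n) (Fin n) ℂ := fun i j => gm L i j p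

/-- The inverse metric tensor `g^{l̄ i}`. -/
def gi (l i : Fin n) (p : Pt n) : ℂ := (gmat L p)⁻¹ l i

/-- The Chern–Finsler nonlinear connection coefficients
`N^i_k := g^{m̄ i} (∂g_{l m̄}/∂z^k) η^l`. -/
def Nc (i k : Fin n) (p : Pt n) : ℂ :=
  ∑ m, ∑ l, gi L m i p * dz (gm L l m) k p * p.2 l

/-- The horizontal derivation `δ_k := ∂/∂z^k − N^j_k ∂/∂η^j`. -/
def del (f : Pt n → ℂ) (k : Fin n) (p : Pt n) : ℂ :=
  dz f k p - ∑ j, Nc L j k p * de f j p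

/-- The conjugate horizontal derivation `δ_k̄ := ∂/∂z̄^k − N̄^j_k ∂/∂η̄^j`. -/
def delbar (f : Pt n → ℂ) (k : Fin n) (p : Pt n) : ℂ :=
  dzbar f k p - ∑ j, (starRingEnd ℂ) (Nc L j k p) * debar f j p

/-- The horizontal Chern–Finsler connection coefficients `L^i_{jk} := g^{l̄ i} δ_k(g_{j l̄})`. -/
def Lc (i j k : Fin n) (p : Pt n) : ℂ := ∑ l, gi L l i p * del L (gm L j l) k p

/-- The vertical Chern–Finsler connection coefficients `C^i_{jk} := g^{l̄ i} ∂g_{j l̄}/∂η^k`. -/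
def Cc (i j k : Fin n) (p : Pt n) : ℂ := ∑ l, gi L l i p * de (gm L j l) k p

/-- The spray coefficients `G^i := ½ N^i_j η^j`. -/
def Gs (i : Fin n) (p : Pt n) : ℂ := (1 / 2) * ∑ j, Nc L i j p * p.2 j

/-- The canonical horizontal derivation `δ̊_k := ∂/∂z^k − (∂G^j/∂η^k) ∂/∂η^j`. -/
def delc (f : Pt n → ℂ) (k : Fin n) (p : Pt n) : ℂ :=
  dz f k p - ∑ j, de (Gs L j) k p * de f j p

/-- `F := √L`. -/
def Fh (p : Pt n) : ℂ := (Real.sqrt ((L p).re) : ℂ)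

/-- `l^i := η^i / F`. -/
def lup (i : Fin n) (p : Pt n) : ℂ := p.2 i / Fh L p

/-- `l_i := g_{i j̄} η̄^j / F`. -/
def llow (i : Fin n) (p : Pt n) : ℂ :=
  (∑ j, gm L i j p * (starRingEnd ℂ) (p.2 j)) / Fh L p

/-- `√g` where `g := det(g_{i j̄})`. -/
def sg (p : Pt n) : ℂ := (Real.sqrt ((gmat L p).det.re) : ℂ)

/-- The metric is Kähler. -/
def IsKahler (D : Set (Pt n)) : Prop := ∀ p ∈ D, ∀ i j k, Lc L i j k p = Lc L i k j p

/-- The metric is weakly Kähler. -/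
def IsWeaklyKahler (D : Set (Pt n)) : Prop :=
  ∀ p ∈ D, ∀ k, (∑ i, ∑ j, ∑ l, gm L i l p * (Lc L i j k p - Lc L i k j p) *
    p.2 j * (starRingEnd ℂ) (p.2 l)) = 0

/-- The metric is purely Hermitian: `g_{i j̄}` does not depend on the fibre variable. -/
def IsPurelyHermitian (D : Set (Pt n)) : Prop :=
  ∀ p ∈ D, ∀ i j k, de (gm L i j) k p = 0 ∧ debar (gm L i j) k p = 0

/-- The metric is a complex Berwald metric: Kähler with `L^i_{jk}` independent of the
fibre variable. -/
def IsBerwald (D : Set (Pt n)) : Prop :=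
  IsKahler L D ∧ ∀ p ∈ D, ∀ i j k l, de (Lc L i j k) l p = 0 ∧ debar (Lc L i j k) l p = 0

/-- The metric is a complex Landsberg metric: the Berwald and Rund connections coincide. -/
def IsLandsberg (D : Set (Pt n)) : Prop :=
  ∀ p ∈ D, ∀ i j k, de (de (Gs L i) k) j p =
    (1 / 2) * ∑ l, gi L l i p * (delc L (gm L j l) k p + delc L (gm L k l) j p)

/-- `m^i` of the local complex Berwald frame: `m¹ = −l₂/√g`, `m² = l₁/√g`. -/
def mup (L : Pt 2 → ℂ) (i : Fin 2) (p : Pt 2) : ℂ :=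
  if i = 0 then -(llow L 1 p) / sg L p else llow L 0 p / sg L p

/-- `m_i := g_{i j̄} m̄^j`. -/
def mlow (L : Pt 2 → ℂ) (i : Fin 2) (p : Pt 2) : ℂ :=
  ∑ j, gm L i j p * (starRingEnd ℂ) (mup L j p)

/-- `A := m^j m^k l_h C^h_{kj}`. -/
def sA (L : Pt 2 → ℂ) (p : Pt 2) : ℂ :=
  ∑ j, ∑ k, ∑ h, mup L j p * mup L k p * llow L h p * Cc L h k j p

/-- `B := m_h m^k m^j C^h_{jk}`. -/
def sB (L : Pt 2 → ℂ) (p : Pt 2) : ℂ :=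
  ∑ j, ∑ k, ∑ h, mlow L h p * mup L k p * mup L j p * Cc L h j k p

/-- `J := l^j l^k l_i L^i_{jk}`. -/
def sJ (L : Pt 2 → ℂ) (p : Pt 2) : ℂ :=
  ∑ j, ∑ k, ∑ i, lup L j p * lup L k p * llow L i p * Lc L i j k p

/-- `U := m^j l^k l_i L^i_{jk}`. -/
def sU (L : Pt 2 → ℂ) (p : Pt 2) : ℂ :=
  ∑ j, ∑ k, ∑ i, mup L j p * lup L k p * llow L i p * Lc L i j k p

/-- `V := l^j m^k l_i L^i_{jk}`. -/
def sV (L : Pt 2 → ℂ) (p : Pt 2) : ℂ :=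
  ∑ j, ∑ k, ∑ i, lup L j p * mup L k p * llow L i p * Lc L i j k p

/-- `X := m^j m^k l_i L^i_{jk}`. -/
def sX (L : Pt 2 → ℂ) (p : Pt 2) : ℂ :=
  ∑ j, ∑ k, ∑ i, mup L j p * mup L k p * llow L i p * Lc L i j k p

/-- `O := l^j l^k m_i L^i_{jk}`. -/
def sO (L : Pt 2 → ℂ) (p : Pt 2) : ℂ :=
  ∑ j, ∑ k, ∑ i, lup L j p * lup L k p * mlow L i p * Lc L i j k p

/-- `Y := m^j l^k m_i L^i_{jk}`. -/
def sY (L : Pt 2 → ℂ) (p : Pt 2) : ℂ :=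
  ∑ j, ∑ k, ∑ i, mup L j p * lup L k p * mlow L i p * Lc L i j k p

/-- `E := l^j m^k m_i L^i_{jk}`. -/
def sE (L : Pt 2 → ℂ) (p : Pt 2) : ℂ :=
  ∑ j, ∑ k, ∑ i, lup L j p * mup L k p * mlow L i p * Lc L i j k p

/-- `H := m^j m^k m_i L^i_{jk}`. -/
def sH (L : Pt 2 → ℂ) (p : Pt 2) : ℂ :=
  ∑ j, ∑ k, ∑ i, mup L j p * mup L k p * mlow L i p * Lc L i j k p

/-- The vertical curvature invariant `I := −(∂B/∂η̄^s) m̄^s − B B̄/2`. -/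
def vI (L : Pt 2 → ℂ) (p : Pt 2) : ℂ :=
  -(∑ s, debar (sB L) s p * (starRingEnd ℂ) (mup L s p)) -
    sB L p * (starRingEnd ℂ) (sB L p) / 2

/-- The `v v̄`-Riemann type tensor `S_{r̄ j h̄ k} := −g_{i r̄} ∂C^i_{jk}/∂η̄^h`. -/
def Sv (L : Pt 2 → ℂ) (r j h k : Fin 2) (p : Pt 2) : ℂ :=
  -∑ i, gm L i r p * debar (Cc L i j k) h p

/-- The `h h̄`-Riemann type tensor
`R_{r̄ j h̄ k} := g_{i r̄} (−δ_h̄(L^i_{jk}) − δ_h̄(N^l_k) C^i_{jl})`. -/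
def Rh (L : Pt 2 → ℂ) (r j h k : Fin 2) (p : Pt 2) : ℂ :=
  ∑ i, gm L i r p *
    (-(delbar L (Lc L i j k) h p) - ∑ l, delbar L (Nc L l k) h p * Cc L i j l p)

/-- The horizontal curvature invariant `K := −(1/F) δ_k̄(J) η̄^k`. -/
def hK (L : Pt 2 → ℂ) (p : Pt 2) : ℂ :=
  -(1 / Fh L p) * ∑ k, delbar L (sJ L) k p * (starRingEnd ℂ) (p.2 k)

/-- The horizontal curvature invariant
`W := −δ_s̄(H) m̄^s − ½ H (V̄+H̄) − B F δ_s̄(E) m̄^s`. -/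
def hW (L : Pt 2 → ℂ) (p : Pt 2) : ℂ :=
  -(∑ s, delbar L (sH L) s p * (starRingEnd ℂ) (mup L s p)) -
    (1 / 2) * sH L p * ((starRingEnd ℂ) (sV L p) + (starRingEnd ℂ) (sH L p)) -
    sB L p * Fh L p * ∑ s, delbar L (sE L) s p * (starRingEnd ℂ) (mup L s p)

/-- The weak symmetry condition `R_{0̄ k 0̄ 0} = R_{0̄ 0 0̄ k}`, i.e.
`R_{r̄ k h̄ s} η̄^r η̄^h η^s = R_{r̄ s h̄ k} η̄^r η^s η̄^h`. -/
def WeakSym (L : Pt 2 → ℂ) (D : Set (Pt 2)) : Prop :=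
  ∀ p ∈ D, ∀ k,
    (∑ r, ∑ h, ∑ s, Rh L r k h s p * (starRingEnd ℂ) (p.2 r) *
      (starRingEnd ℂ) (p.2 h) * p.2 s) =
    ∑ r, ∑ s, ∑ h, Rh L r s h k p * (starRingEnd ℂ) (p.2 r) * p.2 s *
      (starRingEnd ℂ) (p.2 h)


/-- The common form `½ (∂f/∂x^k + s ∂f/∂y^k)` of the two fibre Wirtinger derivatives. -/
def wd (s : ℂ) (f : Pt n → ℂ) (k : Fin n) (p : Pt n) : ℂ :=
  (1 / 2) * (fderiv ℝ f p (0, (Pi.single k 1 : Fin n → ℂ)) +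
    s * fderiv ℝ f p (0, (Pi.single k Complex.I : Fin n → ℂ)))

theorem de_eq_wd : (de : (Pt n → ℂ) → Fin n → Pt n → ℂ) = wd (-Complex.I) := by
  funext f k p
  simp only [de, wd]
  ring

theorem debar_eq_wd : (debar : (Pt n → ℂ) → Fin n → Pt n → ℂ) = wd Complex.I := rfl

section Wirtinger

variable {s t : ℂ} {f h : Pt n → ℂ} {D : Set (Pt n)} {p : Pt n}

theorem wd_congr (hD : IsOpen D) (hfh : ∀ q ∈ D, f q = h q) (hp : p ∈ D) (k : Fin n) :
    wd s f k p = wd s h k p := by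
  have : f =ᶠ[nhds p] h := Filter.eventuallyEq_of_mem (hD.mem_nhds hp) hfh
  simp only [wd, this.fderiv_eq]

theorem wd_const (c : ℂ) (k : Fin n) : wd s (fun _ : Pt n => c) k p = 0 := by
  simp [wd]

theorem wd_mul (hf : DifferentiableAt ℝ f p) (hh : DifferentiableAt ℝ h p) (k : Fin n) :
    wd s (fun q => f q * h q) k p = wd s f k p * h p + f p * wd s h k p := by
  simp only [wd, fderiv_fun_mul hf hh, _root_.add_apply,
    _root_.smul_apply, smul_eq_mul]
  ring

theorem wd_sub (hf : DifferentiableAt ℝ f p) (hh : DifferentiableAt ℝ h p) (k : Fin n) :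
    wd s (fun q => f q - h q) k p = wd s f k p - wd s h k p := by
  simp only [wd, fderiv_fun_sub hf hh, _root_.sub_apply]
  ring

theorem wd_sum {ι : Type*} (u : Finset ι) {f : ι → Pt n → ℂ}
    (hf : ∀ i ∈ u, DifferentiableAt ℝ (f i) p) (k : Fin n) :
    wd s (fun q => ∑ i ∈ u, f i q) k p = ∑ i ∈ u, wd s (f i) k p := by
  simp only [wd, fderiv_fun_sum hf, _root_.sum_apply, Finset.mul_sum,
    ← Finset.sum_add_distrib]

theorem de_sum_mul {f h : Fin n → Pt n → ℂ} (hf : ∀ k, DifferentiableAt ℝ (f k) p)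
    (hh : ∀ k, DifferentiableAt ℝ (h k) p) (i : Fin n) :
    de (fun q => ∑ k, f k q * h k q) i p =
      ∑ k, (de (f k) i p * h k p + f k p * de (h k) i p) := by
  rw [de_eq_wd, wd_sum (f := fun k q => f k q * h k q) _ fun k _ => (hf k).mul (hh k)]
  exact Finset.sum_congr rfl fun k _ => wd_mul (hf k) (hh k) i

theorem star_wd (f : Pt n → ℂ) (k : Fin n) (p : Pt n) :
    (starRingEnd ℂ) (wd s f k p) =
      wd ((starRingEnd ℂ) s) (fun q => (starRingEnd ℂ) (f q)) k p := by
  have : fderiv ℝ (fun q => (starRingEnd ℂ) (f q)) p =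
      (Complex.conjCLE : ℂ →L[ℝ] ℂ).comp (fderiv ℝ f p) :=
    Complex.conjCLE.comp_fderiv (f := f) (x := p)
  simp only [wd, this, map_mul, map_add, map_div₀, map_one, map_ofNat]
  rfl

theorem star_de (f : Pt n → ℂ) (k : Fin n) (p : Pt n) :
    (starRingEnd ℂ) (de f k p) = debar (fun q => (starRingEnd ℂ) (f q)) k p := by
  simp [de_eq_wd, debar_eq_wd, star_wd]

theorem star_debar (f : Pt n → ℂ) (k : Fin n) (p : Pt n) :
    (starRingEnd ℂ) (debar f k p) = de (fun q => (starRingEnd ℂ) (f q)) k p := by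
  simp [de_eq_wd, debar_eq_wd, star_wd]

theorem fderiv_fibre_coord (i : Fin n) (p v : Pt n) :
    fderiv ℝ (fun q : Pt n => q.2 i) p v = v.2 i := by
  have : HasFDerivAt (fun q : Pt n => q.2 i)
      ((ContinuousLinearMap.proj (R := ℝ) (φ := fun _ : Fin n => ℂ) i).comp
        (ContinuousLinearMap.snd ℝ (Fin n → ℂ) (Fin n → ℂ))) p :=
    ((ContinuousLinearMap.proj (R := ℝ) (φ := fun _ : Fin n => ℂ) i).comp
      (ContinuousLinearMap.snd ℝ (Fin n → ℂ) (Fin n → ℂ))).hasFDerivAt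
  rw [this.fderiv]
  rfl

theorem de_coord (i k : Fin n) : de (fun q : Pt n => q.2 i) k p = if i = k then 1 else 0 := by
  simp only [de, fderiv_fibre_coord, Pi.single_apply]
  split_ifs
  · rw [Complex.I_mul_I]; norm_num
  · simp

theorem debar_coord (i k : Fin n) : debar (fun q : Pt n => q.2 i) k p = 0 := by
  simp only [debar, fderiv_fibre_coord, Pi.single_apply]
  split_ifs
  · rw [Complex.I_mul_I]; norm_num
  · simp

theorem de_star_coord (i k : Fin n) :
    de (fun q : Pt n => (starRingEnd ℂ) (q.2 i)) k p = 0 := by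
  rw [← star_debar, debar_coord, map_zero]

theorem differentiableAt_star_coord (i : Fin n) (p : Pt n) :
    DifferentiableAt ℝ (fun q : Pt n => (starRingEnd ℂ) (q.2 i)) p :=
  Complex.conjCLE.differentiableAt.comp p (f := fun q : Pt n => q.2 i) (by fun_prop)

theorem differentiableAt_of_contDiffOn (hD : IsOpen D) (hf : ContDiffOn ℝ (⊤ : ℕ∞) f D)
    (hp : p ∈ D) : DifferentiableAt ℝ f p :=
  (hf.contDiffAt (hD.mem_nhds hp)).differentiableAt (by simp)

theorem contDiffOn_wd (hD : IsOpen D) (hf : ContDiffOn ℝ (⊤ : ℕ∞) f D) (s : ℂ) (k : Fin n) :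
    ContDiffOn ℝ (⊤ : ℕ∞) (wd s f k) D := by
  have h1 : ContDiffOn ℝ (⊤ : ℕ∞) (fderiv ℝ f) D := hf.fderiv_of_isOpen hD (by simp)
  exact contDiffOn_const.mul ((h1.clm_apply contDiffOn_const).add
    (contDiffOn_const.mul (h1.clm_apply contDiffOn_const)))

theorem wd_comm (hD : IsOpen D) (hf : ContDiffOn ℝ (⊤ : ℕ∞) f D) (hp : p ∈ D) (i j : Fin n) :
    wd s (wd t f j) i p = wd t (wd s f i) j p := by
  have hfp := hf.contDiffAt (hD.mem_nhds hp)
  have hsymm : IsSymmSndFDerivAt ℝ f p := hfp.isSymmSndFDerivAt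
    (by rw [minSmoothness_of_isRCLikeNormedField]; exact WithTop.coe_le_coe.2 (le_top : (2 : ℕ∞) ≤ ⊤))
  have hd : DifferentiableAt ℝ (fderiv ℝ f) p :=
    (hfp.fderiv_right (m := (⊤ : ℕ∞)) (by simp)).differentiableAt (by simp)
  have key : ∀ (r : ℂ) (k : Fin n) (v : Pt n), fderiv ℝ (wd r f k) p v =
      (1 / 2) * (fderiv ℝ (fderiv ℝ f) p v (0, Pi.single k 1) +
        r * fderiv ℝ (fderiv ℝ f) p v (0, Pi.single k Complex.I)) := by
    intro r k v
    have h1 : ∀ w : Pt n, HasFDerivAt (fun q => fderiv ℝ f q w)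
        ((fderiv ℝ (fderiv ℝ f) p).flip w) p := fun w => by
      simpa using hd.hasFDerivAt.clm_apply (hasFDerivAt_const w p)
    have h2 := ((h1 (0, Pi.single k 1)).add
      ((h1 (0, Pi.single k Complex.I)).const_mul r)).const_mul (1 / 2 : ℂ)
    have h3 : HasFDerivAt (wd r f k) _ p := h2
    rw [h3.fderiv]
    simp
    ring
  simp only [wd, key]
  simp only [hsymm.eq (0, Pi.single i _) (0, Pi.single j _)]
  ring

end Wirtinger

theorem fderiv_fibre_eq_sum (f : Pt n → ℂ) (p : Pt n) (v : Fin n → ℂ) :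
    fderiv ℝ f p (0, v) =
      ∑ k, (de f k p * v k + debar f k p * (starRingEnd ℂ) (v k)) := by
  have hv : ((0, v) : Pt n) = ∑ k, ((v k).re • ((0, Pi.single k 1) : Pt n) +
      (v k).im • ((0, Pi.single k Complex.I) : Pt n)) := by
    refine Prod.ext ?_ ?_
    · simp [Prod.fst_sum]
    · funext j
      simp [Prod.snd_sum, Finset.sum_apply, Pi.single_apply, Finset.sum_add_distrib]
  rw [hv, map_sum]
  refine Finset.sum_congr rfl fun k _ => ?_
  simp only [map_add, map_smul, de, debar, Complex.real_smul]
  rw [← Complex.re_add_im (v k)]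
  simp only [map_add, map_mul, Complex.conj_ofReal, Complex.conj_I, Complex.add_re,
    Complex.add_im, Complex.ofReal_re, Complex.ofReal_im, Complex.mul_re, Complex.mul_im,
    Complex.I_re, Complex.I_im, mul_zero, mul_one, sub_zero, add_zero, zero_add]
  linear_combination ((fderiv ℝ f p (0, Pi.single k Complex.I)) * (v k).im) * Complex.I_mul_I

namespace IsCFM

variable {D : Set (Pt n)} {L : Pt n → ℂ} {p : Pt n}

theorem conj_eq (hL : IsCFM n D L) (hp : p ∈ D) : (starRingEnd ℂ) (L p) = L p :=
  Complex.conj_eq_iff_im.2 (hL.real_im p hp)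

theorem fderiv_radial (hL : IsCFM n D L) (hp : p ∈ D) (c : ℂ) :
    fderiv ℝ L p (0, c • p.2) = 2 * (c.re : ℂ) * L p := by
  have hγ : HasDerivAt (fun t : ℝ => ((p.1, (1 + t * c) • p.2) : Pt n)) (0, c • p.2) 0 := by
    refine (hasDerivAt_const _ _).prodMk ?_
    have h1 : HasDerivAt (fun t : ℝ => 1 + (t : ℂ) * c) c 0 := by
      simpa using ((Complex.ofRealCLM.hasDerivAt (x := (0 : ℝ))).mul_const c).const_add 1
    exact h1.smul_const p.2
  have hLp : HasFDerivAt L (fderiv ℝ L p) ((p.1, (1 + ((0 : ℝ) : ℂ) * c) • p.2) : Pt n) := by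
    simpa using (differentiableAt_of_contDiffOn hL.openD hL.smooth hp).hasFDerivAt
  have h1 := hLp.comp_hasDerivAt (0 : ℝ) hγ
  have h2 : HasDerivAt (fun t : ℝ => ((Complex.normSq (1 + t * c) : ℝ) : ℂ) * L p)
      (2 * (c.re : ℂ) * L p) 0 := by
    have h3 : HasDerivAt (fun t : ℝ => (1 + t * c.re) * (1 + t * c.re) + t * c.im * (t * c.im))
        (2 * c.re) 0 := by
      have ha : HasDerivAt (fun t : ℝ => 1 + t * c.re) c.re 0 := by
        simpa using ((hasDerivAt_id (0 : ℝ)).mul_const c.re).const_add 1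
      have hb : HasDerivAt (fun t : ℝ => t * c.im) c.im 0 := by
        simpa using (hasDerivAt_id (0 : ℝ)).mul_const c.im
      refine ((ha.mul ha).add (hb.mul hb)).congr_deriv ?_
      ring
    have h4 := ((h3.ofReal_comp).mul_const (L p)).congr_deriv
      (g' := 2 * (c.re : ℂ) * L p) (by push_cast; ring)
    refine h4.congr_of_eventuallyEq (Filter.Eventually.of_forall fun t => ?_)
    simp [Complex.normSq_apply]
  have hne : ∀ᶠ t : ℝ in nhds 0, 1 + (t : ℂ) * c ≠ 0 := by
    have : ContinuousAt (fun t : ℝ => 1 + (t : ℂ) * c) 0 := by fun_prop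
    exact this.eventually_ne (by simp)
  have h5 : (fun t : ℝ => L (p.1, (1 + t * c) • p.2)) =ᶠ[nhds 0]
      fun t : ℝ => ((Complex.normSq (1 + t * c) : ℝ) : ℂ) * L p :=
    hne.mono fun t ht => hL.homog p hp _ ht
  exact h1.unique (h2.congr_of_eventuallyEq h5)

theorem sum_de_mul (hL : IsCFM n D L) (hp : p ∈ D) : ∑ k, de L k p * p.2 k = L p := by
  have h1 := hL.fderiv_radial hp 1
  have h2 := hL.fderiv_radial hp Complex.I
  rw [fderiv_fibre_eq_sum, Finset.sum_add_distrib] at h1 h2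
  simp only [Pi.smul_apply, smul_eq_mul, map_mul, Complex.conj_I, one_mul,
    Complex.one_re, Complex.I_re, mul_left_comm _ Complex.I, mul_left_comm _ (-Complex.I),
    ← Finset.mul_sum, Complex.ofReal_one, Complex.ofReal_zero] at h1 h2
  linear_combination (1 / 2) * h1 - (Complex.I / 2) * h2 +
    (1 / 2) * (∑ k, de L k p * p.2 k -
      ∑ k, debar L k p * (starRingEnd ℂ) (p.2 k)) * Complex.I_mul_I

theorem star_de_eq (hL : IsCFM n D L) (hp : p ∈ D) (k : Fin n) :
    (starRingEnd ℂ) (de L k p) = debar L k p := by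
  rw [star_de]
  exact wd_congr hL.openD (fun q hq => hL.conj_eq hq) hp k

/-- `η^k L_{ik} = 0`. -/
theorem sum_de_de_mul (hL : IsCFM n D L) (hp : p ∈ D) (i : Fin n) :
    ∑ k, de (de L k) i p * p.2 k = 0 := by
  have hd : ∀ k, DifferentiableAt ℝ (de L k) p := fun k =>
    differentiableAt_of_contDiffOn hL.openD (de_eq_wd ▸ contDiffOn_wd hL.openD hL.smooth _ k) hp
  have h1 : de (fun q => ∑ k, de L k q * q.2 k) i p = de L i p := by
    rw [de_eq_wd]
    exact wd_congr hL.openD (fun q hq => de_eq_wd ▸ hL.sum_de_mul hq) hp i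
  have h2 := de_sum_mul (h := fun k q => q.2 k) hd (fun k => by fun_prop) i
  simp only [de_coord, mul_ite, mul_one, mul_zero, Finset.sum_add_distrib, Finset.sum_ite_eq',
    Finset.mem_univ, if_true] at h2
  linear_combination h2.symm.trans h1

/-- `g_{i k̄} η̄^k = L_i`. -/
theorem sum_gm_mul_conj (hL : IsCFM n D L) (hp : p ∈ D) (i : Fin n) :
    ∑ k, gm L i k p * (starRingEnd ℂ) (p.2 k) = de L i p := by
  have hd : ∀ k, DifferentiableAt ℝ (debar L k) p := fun k =>
    differentiableAt_of_contDiffOn hL.openD (contDiffOn_wd hL.openD hL.smooth _ k) hp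
  have h0 : ∀ q ∈ D, ∑ k, debar L k q * (starRingEnd ℂ) (q.2 k) = L q := fun q hq => by
    rw [← hL.conj_eq hq, ← hL.sum_de_mul hq, map_sum]
    exact Finset.sum_congr rfl fun k _ => by rw [map_mul, hL.star_de_eq hq]
  have h1 : de (fun q => ∑ k, debar L k q * (starRingEnd ℂ) (q.2 k)) i p = de L i p := by
    rw [de_eq_wd]
    exact wd_congr hL.openD h0 hp i
  rw [← h1]
  simp only [de_sum_mul hd (fun k => differentiableAt_star_coord k p), de_star_coord, mul_zero,
    add_zero, gm]

theorem contDiffOn_de (hL : IsCFM n D L) (i : Fin n) : ContDiffOn ℝ (⊤ : ℕ∞) (de L i) D :=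
  de_eq_wd ▸ contDiffOn_wd hL.openD hL.smooth _ i

theorem contDiffOn_de_de (hL : IsCFM n D L) (i j : Fin n) :
    ContDiffOn ℝ (⊤ : ℕ∞) (de (de L i) j) D := by
  rw [de_eq_wd]
  exact contDiffOn_wd hL.openD (contDiffOn_wd hL.openD hL.smooth _ i) _ j

theorem contDiffOn_gm (hL : IsCFM n D L) (i j : Fin n) :
    ContDiffOn ℝ (⊤ : ℕ∞) (gm L i j) D := by
  rw [gm, de_eq_wd]
  exact contDiffOn_wd hL.openD (contDiffOn_wd hL.openD hL.smooth _ j) _ i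

theorem de_comm (hL : IsCFM n D L) (hp : p ∈ D) (i j : Fin n) :
    de (de L i) j p = de (de L j) i p := by
  rw [de_eq_wd]
  exact wd_comm hL.openD hL.smooth hp j i

theorem gm_eq (hL : IsCFM n D L) (hp : p ∈ D) (i j : Fin n) :
    gm L i j p = debar (de L i) j p := by
  rw [gm, de_eq_wd, debar_eq_wd]
  exact wd_comm hL.openD hL.smooth hp i j

/-- `∂g_{i l̄}/∂η^j = ∂L_{ij}/∂η̄^l`. -/
theorem de_gm (hL : IsCFM n D L) (hp : p ∈ D) (i l j : Fin n) :
    de (gm L i l) j p = debar (de (de L i) j) l p := by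
  have h1 : de (gm L i l) j p = de (debar (de L i) l) j p := by
    rw [de_eq_wd]
    exact wd_congr hL.openD (fun q hq => de_eq_wd ▸ hL.gm_eq hq i l) hp j
  rw [h1, de_eq_wd, debar_eq_wd]
  exact wd_comm hL.openD (contDiffOn_wd hL.openD hL.smooth _ i) hp j l

/-- `∂g_{i j̄}/∂η̄^k` is the conjugate of `∂g_{j ī}/∂η^k`. -/
theorem debar_gm (hL : IsCFM n D L) (hp : p ∈ D) (i j k : Fin n) :
    debar (gm L i j) k p = (starRingEnd ℂ) (de (gm L j i) k p) := by
  rw [star_de]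
  exact wd_congr hL.openD (fun q hq => (hL.hermitian q hq j i).symm) hp k

/-- `∂g_{i l̄}/∂η^j η̄^l = L_{ij}`. -/
theorem sum_de_gm_mul_conj (hL : IsCFM n D L) (hp : p ∈ D) (i j : Fin n) :
    ∑ l, de (gm L i l) j p * (starRingEnd ℂ) (p.2 l) = de (de L i) j p := by
  have hd : ∀ k, DifferentiableAt ℝ (gm L i k) p := fun k =>
    differentiableAt_of_contDiffOn hL.openD (hL.contDiffOn_gm i k) hp
  have h1 : de (fun q => ∑ k, gm L i k q * (starRingEnd ℂ) (q.2 k)) j p = de (de L i) j p := by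
    rw [de_eq_wd]
    exact wd_congr hL.openD (fun q hq => de_eq_wd ▸ hL.sum_gm_mul_conj hq i) hp j
  rw [← h1]
  simp only [de_sum_mul hd (fun k => differentiableAt_star_coord k p), de_star_coord, mul_zero,
    add_zero]

end IsCFM

namespace IsCFM

variable {D : Set (Pt 2)} {L : Pt 2 → ℂ} {p : Pt 2}

theorem det_gmat (L : Pt 2 → ℂ) (p : Pt 2) :
    (gmat L p).det = gm L 0 0 p * gm L 1 1 p - gm L 0 1 p * gm L 1 0 p :=
  Matrix.det_fin_two _

theorem conj_det (hL : IsCFM 2 D L) (hp : p ∈ D) :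
    (starRingEnd ℂ) (gmat L p).det = (gmat L p).det := by
  simp only [det_gmat, map_sub, map_mul, hL.hermitian p hp]
  ring

theorem det_re_pos (hL : IsCFM 2 D L) (hp : p ∈ D) : 0 < (gmat L p).det.re := by
  have hG := Complex.conj_eq_iff_im.1 (hL.conj_det hp)
  have him := Complex.conj_eq_iff_im.1 (hL.hermitian p hp 0 0)
  have h0 : 0 < (gm L 0 0 p).re := by
    have := hL.posdef p hp ![1, 0] fun h => by simpa using congrFun h 0
    simpa using this
  have h1 := hL.posdef p hp ![-gm L 1 0 p, gm L 0 0 p] fun h => by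
    have := congrFun h 1
    simp only [Matrix.cons_val_one, Matrix.cons_val_fin_one, Pi.zero_apply] at this
    simp [this] at h0
  have h2 : (∑ i, ∑ j, gm L i j p * (![-gm L 1 0 p, gm L 0 0 p] : Fin 2 → ℂ) i *
      (starRingEnd ℂ) ((![-gm L 1 0 p, gm L 0 0 p] : Fin 2 → ℂ) j)) =
      (gmat L p).det * gm L 0 0 p := by
    simp only [Fin.sum_univ_two, det_gmat, Matrix.cons_val_zero, Matrix.cons_val_one,
      Matrix.cons_val_fin_one, map_neg, hL.hermitian p hp]
    ring
  rw [h2, Complex.mul_re, hG, him, zero_mul, sub_zero] at h1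
  exact pos_of_mul_pos_left h1 h0.le

theorem det_ne_zero (hL : IsCFM 2 D L) (hp : p ∈ D) : (gmat L p).det ≠ 0 := fun h => by
  simpa [h] using hL.det_re_pos hp

theorem apply_ne_zero (hL : IsCFM 2 D L) (hp : p ∈ D) : L p ≠ 0 := fun h => by
  simpa [h] using hL.pos p hp

theorem sg_mul_self (hL : IsCFM 2 D L) (hp : p ∈ D) : sg L p * sg L p = (gmat L p).det := by
  rw [sg, ← Complex.ofReal_mul, Real.mul_self_sqrt (hL.det_re_pos hp).le]
  exact Complex.conj_eq_iff_re.1 (hL.conj_det hp)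

theorem Fh_mul_self (hL : IsCFM 2 D L) (hp : p ∈ D) : Fh L p * Fh L p = L p := by
  rw [Fh, ← Complex.ofReal_mul, Real.mul_self_sqrt (hL.pos p hp).le]
  exact Complex.conj_eq_iff_re.1 (hL.conj_eq hp)

theorem sg_ne_zero (hL : IsCFM 2 D L) (hp : p ∈ D) : sg L p ≠ 0 := fun h =>
  hL.det_ne_zero hp (by rw [← hL.sg_mul_self hp, h, zero_mul])

theorem Fh_ne_zero (hL : IsCFM 2 D L) (hp : p ∈ D) : Fh L p ≠ 0 := fun h =>
  hL.apply_ne_zero hp (by rw [← hL.Fh_mul_self hp, h, zero_mul])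

theorem llow_eq (hL : IsCFM 2 D L) (hp : p ∈ D) (i : Fin 2) :
    llow L i p = de L i p / Fh L p := by
  rw [llow, hL.sum_gm_mul_conj hp]

/-- Lowering the upper index of `C^h_{ki}`: `(g_{h j̄} w^j) C^h_{ki} = w^l ∂g_{k l̄}/∂η^i`. -/
theorem sum_lower_mul_Cc (hL : IsCFM 2 D L) (hp : p ∈ D) (w : Fin 2 → ℂ) (k i : Fin 2) :
    ∑ h, (∑ j, gm L h j p * w j) * Cc L h k i p = ∑ l, w l * de (gm L k l) i p := by
  have hinv : ∀ l j, ∑ h, gi L l h p * gm L h j p = if l = j then 1 else 0 := fun l j => by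
    have := congrFun (congrFun
      (Matrix.nonsing_inv_mul (gmat L p) (isUnit_iff_ne_zero.2 (hL.det_ne_zero hp))) l) j
    rwa [Matrix.mul_apply, Matrix.one_apply] at this
  have h00 := hinv 0 0
  have h01 := hinv 0 1
  have h10 := hinv 1 0
  have h11 := hinv 1 1
  simp only [Fin.sum_univ_two, Fin.isValue, if_true, zero_ne_one, one_ne_zero, if_false]
    at h00 h01 h10 h11
  simp only [Cc, Fin.sum_univ_two]
  linear_combination de (gm L k 0) i p * (w 0 * h00 + w 1 * h01) +
    de (gm L k 1) i p * (w 0 * h10 + w 1 * h11)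

/-- The covector `(η², −η¹)`, which annihilates `η`. -/
def annih (i : Fin 2) (p : Pt 2) : ℂ := if i = 0 then p.2 1 else -p.2 0

/-- The coefficient `a` in `L_{ij} = a ν_i ν_j`, with `ν = (η², −η¹)`. -/
def hessCoeff (L : Pt 2 → ℂ) (p : Pt 2) : ℂ :=
  (de L 1 p * de L 1 p * de (de L 0) 0 p - 2 * (de L 0 p * de L 1 p * de (de L 0) 1 p) +
    de L 0 p * de L 0 p * de (de L 1) 1 p) / (L p * L p)

theorem de_de_eq (hL : IsCFM 2 D L) (hp : p ∈ D) (i j : Fin 2) :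
    de (de L i) j p = annih i p * annih j p * hessCoeff L p := by
  have hne := hL.apply_ne_zero hp
  have hE := hL.sum_de_mul hp
  have h0 := hL.sum_de_de_mul hp 0
  have h1 := hL.sum_de_de_mul hp 1
  have hc := hL.de_comm hp 1 0
  rw [Fin.sum_univ_two] at hE h0 h1
  rw [hc] at h0
  rw [hessCoeff, mul_div_assoc', eq_div_iff (mul_ne_zero hne hne), ← hE]
  fin_cases i <;> fin_cases j <;>
    simp only [annih, Fin.zero_eta, Fin.mk_one, Fin.isValue, if_true, one_ne_zero, if_false, hc]
  · linear_combination (de L 0 p ^ 2 * p.2 0 + 2 * de L 0 p * de L 1 p * p.2 1) * h0 -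
      de L 0 p ^ 2 * p.2 1 * h1
  · linear_combination de L 0 p ^ 2 * p.2 0 * h1 + de L 1 p ^ 2 * p.2 1 * h0
  · linear_combination de L 0 p ^ 2 * p.2 0 * h1 + de L 1 p ^ 2 * p.2 1 * h0
  · linear_combination (de L 1 p ^ 2 * p.2 1 + 2 * de L 0 p * de L 1 p * p.2 0) * h1 -
      de L 1 p ^ 2 * p.2 0 * h0

theorem sA_eq (hL : IsCFM 2 D L) (hp : p ∈ D) :
    sA L p = hessCoeff L p * Fh L p / (gmat L p).det := by
  have hF := hL.Fh_ne_zero hp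
  have hs := hL.sg_ne_zero hp
  have hlow : ∀ k j, ∑ h, llow L h p * Cc L h k j p = de (de L k) j p / Fh L p := by
    intro k j
    have h1 := hL.sum_lower_mul_Cc hp (fun l => (starRingEnd ℂ) (p.2 l) / Fh L p) k j
    have h2 : ∀ h, ∑ l, gm L h l p * ((starRingEnd ℂ) (p.2 l) / Fh L p) = llow L h p := fun h => by
      simp only [llow, Finset.sum_div, mul_div_assoc]
    simp only [h2] at h1
    rw [h1, ← hL.sum_de_gm_mul_conj hp k j, Finset.sum_div]
    exact Finset.sum_congr rfl fun l _ => by ring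
  have h3 : sA L p = ∑ j, ∑ k, mup L j p * mup L k p * (de (de L k) j p / Fh L p) := by
    simp only [sA, ← hlow, Finset.mul_sum, mul_assoc]
  rw [h3, ← hL.sg_mul_self hp]
  simp only [Fin.sum_univ_two, mup, Fin.isValue, if_true, one_ne_zero, if_false, hL.llow_eq hp,
    hessCoeff, hL.de_comm hp 1 0, ← hL.Fh_mul_self hp]
  field_simp
  ring

theorem contDiffOn_hessCoeff (hL : IsCFM 2 D L) : ContDiffOn ℝ (⊤ : ℕ∞) (hessCoeff L) D := by
  unfold hessCoeff
  have h := hL.contDiffOn_de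
  have hh := hL.contDiffOn_de_de
  simp only [div_eq_mul_inv]
  exact (((((h 1).mul (h 1)).mul (hh 0 0)).sub
    (contDiffOn_const.mul (((h 0).mul (h 1)).mul (hh 0 1)))).add
    (((h 0).mul (h 0)).mul (hh 1 1))).mul ((hL.smooth.mul hL.smooth).inv
      fun q hq => mul_ne_zero (hL.apply_ne_zero hq) (hL.apply_ne_zero hq))

/-- `∂g_{i l̄}/∂η^j = ν_i ν_j ∂a/∂η̄^l`. -/
theorem de_gm_eq (hL : IsCFM 2 D L) (hp : p ∈ D) (i l j : Fin 2) :
    de (gm L i l) j p = annih i p * annih j p * debar (hessCoeff L) l p := by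
  have hν : ∀ i, DifferentiableAt ℝ (annih i) p := fun i => by
    unfold annih
    split_ifs <;> fun_prop
  have hν' : ∀ i, wd Complex.I (annih i) l p = 0 := fun i => by
    have h0 : wd Complex.I (fun q : Pt 2 => q.2 0) l p = 0 := debar_coord 0 l
    have h1 : wd Complex.I (fun q : Pt 2 => q.2 1) l p = 0 := debar_coord 1 l
    unfold annih
    split_ifs
    · exact h1
    · have h2 := wd_sub (s := Complex.I) (f := fun _ : Pt 2 => 0) (h := fun q : Pt 2 => q.2 0)
        (p := p) (by fun_prop) (by fun_prop) l
      simpa only [zero_sub, wd_const, h0, neg_zero] using h2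
  rw [hL.de_gm hp, debar_eq_wd, wd_congr hL.openD (fun q hq => hL.de_de_eq hq i j) hp,
    wd_mul (f := fun q => annih i q * annih j q) ((hν i).mul (hν j))
      (differentiableAt_of_contDiffOn hL.openD hL.contDiffOn_hessCoeff hp),
    wd_mul (hν i) (hν j), hν', hν']
  ring

theorem conj_mup (hL : IsCFM 2 D L) (hp : p ∈ D) (i : Fin 2) :
    (starRingEnd ℂ) (mup L i p) =
      (if i = 0 then -debar L 1 p else debar L 0 p) / (Fh L p * sg L p) := by
  have hF : (starRingEnd ℂ) (Fh L p) = Fh L p := Complex.conj_ofReal _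
  have hs : (starRingEnd ℂ) (sg L p) = sg L p := Complex.conj_ofReal _
  unfold mup
  split_ifs <;>
    rw [hL.llow_eq hp, map_div₀, hs] <;>
    simp only [map_neg, map_div₀, hF, hL.star_de_eq hp, ← neg_div, div_div]

theorem sB_eq (hL : IsCFM 2 D L) (hp : p ∈ D) :
    sB L p = L p * L p / (Fh L p * sg L p) ^ 3 * (debar (hessCoeff L) 1 p * debar L 0 p -
      debar (hessCoeff L) 0 p * debar L 1 p) := by
  have hF := hL.Fh_ne_zero hp
  have hs := hL.sg_ne_zero hp
  have hlow := fun j k =>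
    hL.sum_lower_mul_Cc hp (fun l => (starRingEnd ℂ) (mup L l p)) j k
  have hE := hL.sum_de_mul hp
  rw [Fin.sum_univ_two] at hE
  have h3 : sB L p = ∑ j, ∑ k, mup L k p * mup L j p *
      ∑ l, (starRingEnd ℂ) (mup L l p) * de (gm L j l) k p := by
    simp only [sB, ← hlow, mlow, Finset.mul_sum]
    exact Finset.sum_congr rfl fun j _ => Finset.sum_congr rfl fun k _ =>
      Finset.sum_congr rfl fun h _ => by ring
  rw [h3]
  simp only [Fin.sum_univ_two, hL.conj_mup hp, hL.de_gm_eq hp]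
  simp only [mup, annih, Fin.isValue, if_true, one_ne_zero, if_false, hL.llow_eq hp]
  rw [← hE]
  field_simp
  ring

/-- `a` has degree one in `η̄`. -/
theorem sum_debar_hessCoeff (hL : IsCFM 2 D L) (hp : p ∈ D) :
    ∑ l, debar (hessCoeff L) l p * (starRingEnd ℂ) (p.2 l) = hessCoeff L p := by
  have h : ∀ i, annih i p * annih i p *
      ∑ l, debar (hessCoeff L) l p * (starRingEnd ℂ) (p.2 l) =
        annih i p * annih i p * hessCoeff L p := fun i => by
    rw [← hL.de_de_eq hp, ← hL.sum_de_gm_mul_conj hp, Finset.mul_sum]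
    exact Finset.sum_congr rfl fun l _ => by rw [hL.de_gm_eq hp]; ring
  by_cases h0 : annih 0 p = 0
  · by_cases h1 : annih 1 p = 0
    · refine absurd (funext fun i => ?_) (hL.fiber_ne p hp)
      fin_cases i
      · simpa [annih] using h1
      · simpa [annih] using h0
    · exact mul_left_cancel₀ (mul_ne_zero h1 h1) (h 1)
  · exact mul_left_cancel₀ (mul_ne_zero h0 h0) (h 0)

theorem isPurelyHermitian_iff (hL : IsCFM 2 D L) :
    IsPurelyHermitian L D ↔ ∀ p ∈ D, sA L p = 0 := by
  refine ⟨fun h p hp => by simp [sA, Cc, (h p hp _ _ _).1], fun h p hp i j k => ?_⟩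
  have ha : ∀ q ∈ D, hessCoeff L q = 0 := fun q hq => by
    have := h q hq
    rw [hL.sA_eq hq] at this
    simpa [hL.Fh_ne_zero hq, hL.det_ne_zero hq] using this
  have ha' : ∀ l, debar (hessCoeff L) l p = 0 := fun l => by
    rw [debar_eq_wd, wd_congr hL.openD ha hp, wd_const]
  exact ⟨by rw [hL.de_gm_eq hp, ha', mul_zero],
    by rw [hL.debar_gm hp, hL.de_gm_eq hp, ha', mul_zero, map_zero]⟩

theorem vI_eq_zero (hL : IsCFM 2 D L) (hB : ∀ p ∈ D, sB L p = 0) (hp : p ∈ D) :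
    vI L p = 0 := by
  have h : ∀ s, debar (sB L) s p = 0 := fun s => by
    rw [debar_eq_wd, wd_congr hL.openD hB hp, wd_const]
  simp [vI, h, hB p hp]

theorem mul_debar_hessCoeff (hL : IsCFM 2 D L) (hp : p ∈ D) (hB : sB L p = 0) (h : Fin 2) :
    L p * debar (hessCoeff L) h p = hessCoeff L p * debar L h p := by
  have h1 : debar (hessCoeff L) 1 p * debar L 0 p -
      debar (hessCoeff L) 0 p * debar L 1 p = 0 := by
    rw [hL.sB_eq hp] at hB
    simpa [hL.apply_ne_zero hp, hL.Fh_ne_zero hp, hL.sg_ne_zero hp] using hB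
  have h2 := hL.sum_debar_hessCoeff hp
  have h3 := congrArg (starRingEnd ℂ) (hL.sum_de_mul hp)
  simp only [map_sum, map_mul, hL.star_de_eq hp, hL.conj_eq hp] at h3
  rw [Fin.sum_univ_two] at h2 h3
  rw [← h2, ← h3]
  fin_cases h <;> simp only [Fin.zero_eta, Fin.mk_one, Fin.isValue]
  · linear_combination (-(starRingEnd ℂ) (p.2 1)) * h1
  · linear_combination (starRingEnd ℂ) (p.2 0) * h1

theorem debar_det (hL : IsCFM 2 D L) (hp : p ∈ D) (hB : sB L p = 0) (h : Fin 2) :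
    debar (fun q => (gmat L q).det) h p = 0 := by
  have hg : ∀ i j, DifferentiableAt ℝ (gm L i j) p := fun i j =>
    differentiableAt_of_contDiffOn hL.openD (hL.contDiffOn_gm i j) hp
  have hne := hL.apply_ne_zero hp
  have h1 : de (fun q => (gmat L q).det) h p = 0 := by
    have ha := hL.mul_debar_hessCoeff hp hB
    have hl : ∀ j, debar L j p = ∑ i, gm L i j p * p.2 i := fun j => by
      rw [← hL.star_de_eq hp, ← hL.sum_gm_mul_conj hp, map_sum]
      exact Finset.sum_congr rfl fun i _ => by
        rw [map_mul, hL.hermitian p hp, Complex.conj_conj]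
    have ha0 := ha 0
    have ha1 := ha 1
    rw [hl, Fin.sum_univ_two] at ha0 ha1
    have hd : de (fun q => (gmat L q).det) h p =
        de (gm L 0 0) h p * gm L 1 1 p + gm L 0 0 p * de (gm L 1 1) h p -
          (de (gm L 0 1) h p * gm L 1 0 p + gm L 0 1 p * de (gm L 1 0) h p) := by
      simp only [det_gmat, de_eq_wd]
      rw [wd_sub (f := fun q => gm L 0 0 q * gm L 1 1 q) (h := fun q => gm L 0 1 q * gm L 1 0 q)
        ((hg 0 0).mul (hg 1 1)) ((hg 0 1).mul (hg 1 0)), wd_mul (hg 0 0) (hg 1 1),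
        wd_mul (hg 0 1) (hg 1 0)]
    rw [hd]
    refine mul_left_cancel₀ hne ?_
    simp only [hL.de_gm_eq hp]
    simp only [annih, Fin.isValue, if_true, one_ne_zero, if_false]
    generalize (if h = 0 then p.2 1 else -p.2 0) = c
    linear_combination c * (p.2 1 * gm L 1 1 p + p.2 0 * gm L 0 1 p) * ha0 -
      c * (p.2 0 * gm L 0 0 p + p.2 1 * gm L 1 0 p) * ha1
  have h2 := congrArg (starRingEnd ℂ) h1
  rw [star_de, map_zero] at h2
  rw [← h2]
  exact wd_congr hL.openD (fun q hq => (hL.conj_det hq).symm) hp h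

theorem differentiableAt_Fh (hL : IsCFM 2 D L) (hp : p ∈ D) : DifferentiableAt ℝ (Fh L) p := by
  have h1 : DifferentiableAt ℝ (fun q => (L q).re) p :=
    Complex.reCLM.differentiableAt.comp p
      (differentiableAt_of_contDiffOn hL.openD hL.smooth hp)
  exact Complex.ofRealCLM.differentiableAt.comp p (h1.sqrt (hL.pos p hp).ne')

theorem two_mul_Fh_mul_debar (hL : IsCFM 2 D L) (hp : p ∈ D) (h : Fin 2) :
    2 * Fh L p * debar (Fh L) h p = debar L h p := by
  have hF := hL.differentiableAt_Fh hp
  rw [debar_eq_wd, ← wd_congr hL.openD (fun q hq => hL.Fh_mul_self hq) hp, wd_mul hF hF]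
  ring

theorem debar_sA (hL : IsCFM 2 D L) (hp : p ∈ D) (hB : sB L p = 0) (h : Fin 2) :
    debar (sA L) h p = 3 * sA L p / (2 * Fh L p) * (starRingEnd ℂ) (llow L h p) := by
  have hF := hL.differentiableAt_Fh hp
  have hFne := hL.Fh_ne_zero hp
  have hG0 := hL.det_ne_zero hp
  have ha := differentiableAt_of_contDiffOn hL.openD hL.contDiffOn_hessCoeff hp
  have hG : DifferentiableAt ℝ (fun q => (gmat L q).det) p := by
    simp only [det_gmat]
    have hg : ∀ i j, DifferentiableAt ℝ (gm L i j) p := fun i j =>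
      differentiableAt_of_contDiffOn hL.openD (hL.contDiffOn_gm i j) hp
    exact ((hg 0 0).mul (hg 1 1)).sub ((hg 0 1).mul (hg 1 0))
  have hA : DifferentiableAt ℝ (sA L) p := by
    have h1 : DifferentiableAt ℝ (fun q => hessCoeff L q * Fh L q / (gmat L q).det) p :=
      (ha.mul hF).mul (hG.inv hG0)
    exact h1.congr_of_eventuallyEq
      (Filter.eventuallyEq_of_mem (hL.openD.mem_nhds hp) fun q hq => hL.sA_eq hq)
  have hprod : debar (fun q => sA L q * (gmat L q).det) h p =
      debar (fun q => hessCoeff L q * Fh L q) h p :=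
    wd_congr hL.openD (fun q hq => by
      rw [hL.sA_eq hq, div_mul_cancel₀ _ (hL.det_ne_zero hq)]) hp h
  have hdet := hL.debar_det hp hB h
  have hcoeff := hL.mul_debar_hessCoeff hp hB h
  have hFd := hL.two_mul_Fh_mul_debar hp h
  have hconj : (starRingEnd ℂ) (llow L h p) = debar L h p / Fh L p := by
    have hFc : (starRingEnd ℂ) (Fh L p) = Fh L p := Complex.conj_ofReal _
    rw [hL.llow_eq hp, map_div₀, hL.star_de_eq hp, hFc]
  rw [debar_eq_wd] at hprod hdet hcoeff hFd ⊢
  rw [wd_mul hA hG, wd_mul ha hF, hdet] at hprod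
  rw [hconj, hL.sA_eq hp, debar_eq_wd]
  rw [← hL.Fh_mul_self hp] at hcoeff
  field_simp
  linear_combination 2 * Fh L p * hprod + 2 * hcoeff + hessCoeff L p * hFd

end IsCFM

/-- purely Hermitian iff `A = 0`; and if `A` is nowhere zero and `B = 0`
then `I = 0` and `∂A/∂η̄^h = (3A/(2F)) l̄_h`. -/
theorem statement4 (D : Set (Pt 2)) (L : Pt 2 → ℂ) (hL : IsCFM 2 D L) :
    (IsPurelyHermitian L D ↔ ∀ p ∈ D, sA L p = 0) ∧
    ((∀ p ∈ D, sA L p ≠ 0) → (∀ p ∈ D, sB L p = 0) →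
      ∀ p ∈ D, vI L p = 0 ∧ ∀ h, debar (sA L) h p =
        3 * sA L p / (2 * Fh L p) * (starRingEnd ℂ) (llow L h p)) := by
  refine ⟨hL.isPurelyHermitian_iff, fun _ hB p hp => ⟨hL.vI_eq_zero hB hp, fun h => ?_⟩⟩
  exact hL.debar_sA hp (hB p hp) h

end CFinsler
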